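/- Let V be a finite-dimensional vector space over a field k and let φ : ℙ(⋀² V) → ℙ(⋀² V) be a projective linear automorphism (induced by a linear automorphism of ⋀² V) that maps the Grassmannian G of lines (i.e., the set of classes of nonzero decomposable bivectors v ∧ w) into itself. Then φ restricts to a bijection of G. -/

import Mathlib

lemma surj_of_inj_fd {k X : Type*} [Field k] [AddCommGroup X] [Module k X] [FiniteDimensional k X]
    (T : X →ₗ[k] X) (h : Function.Injective T) : Function.Surjective T :=
  LinearMap.injective_iff_surjective.1 h

/-- Linear forms as functions. -/
noncomputable def linFun (k W : Type*) [Field k] [AddCommGroup W] [Module k W] :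
    Submodule k (W → k) :=
  LinearMap.range ({ toFun := fun f => (f : W → k)
                     map_add' := fun _ _ => rfl
                     map_smul' := fun _ _ => rfl } : Module.Dual k W →ₗ[k] (W → k))

lemma mem_linFun {k W : Type*} [Field k] [AddCommGroup W] [Module k W] (f : Module.Dual k W) :
    (f : W → k) ∈ linFun k W := ⟨f, rfl⟩

lemma quad_inv {k W : Type*} [Field k] [AddCommGroup W] [Module k W] [FiniteDimensional k W]
    (A : W ≃ₗ[k] W) (D : Set W) (hA : ∀ x ∈ D, A x ∈ D)
    (hD : ∀ x, (∀ q ∈ linFun k W * linFun k W, (∀ y ∈ D, q y = 0) → q x = 0) → x ∈ D)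
    (x : W) (hx : A x ∈ D) : x ∈ D := by
  set Q := linFun k W * linFun k W with hQ
  have hfg : (linFun k W).FG := by
    unfold linFun
    rw [LinearMap.range_eq_map]
    exact Submodule.FG.map _ Module.Finite.fg_top
  have hQfg : Q.FG := hfg.mul hfg
  have : FiniteDimensional k Q := Module.Finite.iff_fg.2 hQfg
  let I : Submodule k Q :=
    { carrier := {q | ∀ y ∈ D, (q : W → k) y = 0}
      add_mem' := fun {a b} ha hb y hy => by
        simp [ha y hy, hb y hy]
      zero_mem' := fun y hy => by simp
      smul_mem' := fun c a ha y hy => by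
        simp [ha y hy] }
  let T : (W → k) →ₗ[k] (W → k) := LinearMap.funLeft k k A
  have hTQ : ∀ q ∈ Q, T q ∈ Q := by
    intro q hq
    refine Submodule.mul_induction_on hq ?_ ?_
    · rintro _ ⟨f, rfl⟩ _ ⟨g, rfl⟩
      exact Submodule.mul_mem_mul (mem_linFun (f ∘ₗ A.toLinearMap)) (mem_linFun (g ∘ₗ A.toLinearMap))
    · intro a b ha hb
      rw [map_add]
      exact add_mem ha hb
  let TQ : Q →ₗ[k] Q := T.restrict hTQ
  have hTI : ∀ q ∈ I, TQ q ∈ I := fun q hq y hy => hq (A y) (hA y hy)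
  let TI : I →ₗ[k] I := TQ.restrict hTI
  have hinj : Function.Injective TI := by
    intro a b hab
    apply Subtype.ext
    apply Subtype.ext
    apply LinearMap.funLeft_injective_of_surjective k k A A.surjective
    exact congrArg (fun z : I => ((z : Q) : W → k)) hab
  have hsurj : Function.Surjective TI := @surj_of_inj_fd k I _ _ _ inferInstance TI hinj
  apply hD
  intro q hq hqD
  obtain ⟨⟨⟨q', hq'Q⟩, hq'I⟩, h⟩ := hsurj ⟨⟨q, hq⟩, hqD⟩
  have h2 : T q' = q := congrArg (fun z : I => ((z : Q) : W → k)) h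
  rw [← h2]
  exact hq'I (A x) hx

/-- The pairing of a bivector with two linear forms. -/
noncomputable def bpair {k V : Type*} [Field k] [AddCommGroup V] [Module k V]
    (c d : Module.Dual k V) : Module.Dual k (⋀[k]^2 V) :=
  exteriorPower.alternatingMapToDual k V 2 ![c, d]

lemma bpair_mul {k V : Type*} [Field k] [AddCommGroup V] [Module k V]
    (c d : Module.Dual k V) (v w : V) :
    bpair c d (exteriorPower.ιMulti k 2 ![v, w]) = c v * d w - d v * c w := by
  simp [bpair, exteriorPower.alternatingMapToDual_apply_ιMulti, Matrix.det_fin_two]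

lemma dec_iff {k V : Type*} [Field k] [AddCommGroup V] [Module k V] (ω : ⋀[k]^2 V) (v w : V) :
    (ω : ExteriorAlgebra k V) = ExteriorAlgebra.ι k v * ExteriorAlgebra.ι k w ↔
      ω = exteriorPower.ιMulti k 2 ![v, w] := by
  rw [Subtype.ext_iff, exteriorPower.ιMulti_apply_coe]
  simp [ExteriorAlgebra.ιMulti_apply]

lemma bpair_ext {k V : Type*} [Field k] [AddCommGroup V] [Module k V]
    (ω η : ⋀[k]^2 V) (h : ∀ c d, bpair c d ω = bpair c d η) : ω = η := by
  classical
  let b := Module.Free.chooseBasis k V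
  let : LinearOrder (Module.Free.ChooseBasisIndex k V) := linearOrderOfSTO WellOrderingRel
  apply (b.exteriorPower 2).ext_elem
  intro s
  rw [exteriorPower.basis_repr_apply, exteriorPower.basis_repr_apply]
  have key : exteriorPower.ιMultiDual k 2 b s =
      bpair (b.coord (Set.powersetCard.ofFinEmbEquiv.symm s 0))
        (b.coord (Set.powersetCard.ofFinEmbEquiv.symm s 1)) := by
    apply exteriorPower.linearMap_ext
    ext v
    simp [bpair, exteriorPower.alternatingMapToDual_apply_ιMulti, Matrix.det_fin_two]
  rw [key]
  exact h _ _

lemma exists_contract {k V : Type*} [Field k] [AddCommGroup V] [Module k V]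
    [FiniteDimensional k V] (ω : ⋀[k]^2 V) (a : Module.Dual k V) :
    ∃ v : V, ∀ c : Module.Dual k V, c v = bpair a c ω := by
  let F : Module.Dual k (Module.Dual k V) :=
    (LinearMap.applyₗ ω) ∘ₗ
      ((exteriorPower.alternatingMapToDual k V 2).toMultilinearMap.toLinearMap ![a, 0] 1)
  obtain ⟨v, hv⟩ := (Module.evalEquiv k V).surjective F
  refine ⟨v, fun c => ?_⟩
  have := LinearMap.congr_fun hv c
  have h2 : Function.update ![a, 0] 1 c = ![a, c] := by
    ext i; fin_cases i <;> simp
  simpa [F, bpair, h2] using this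

lemma dec_of_quad {k V : Type*} [Field k] [AddCommGroup V] [Module k V]
    [FiniteDimensional k V] (ω : ⋀[k]^2 V)
    (h : ∀ a b c d : Module.Dual k V,
      bpair a b ω * bpair c d ω - bpair a c ω * bpair b d ω + bpair a d ω * bpair b c ω = 0) :
    ∃ v w : V, ω = exteriorPower.ιMulti k 2 ![v, w] := by
  by_cases h0 : ∀ a b, bpair a b ω = 0
  · refine ⟨0, 0, bpair_ext _ _ fun c d => ?_⟩
    rw [h0, bpair_mul]; simp
  · push Not at h0
    obtain ⟨a, b, hab⟩ := h0
    obtain ⟨v, hv⟩ := exists_contract ω a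
    obtain ⟨w, hw⟩ := exists_contract ω b
    refine ⟨(bpair a b ω)⁻¹ • v, w, bpair_ext _ _ fun c d => ?_⟩
    rw [bpair_mul, map_smul, map_smul, hv, hv, hw, hw, smul_eq_mul, smul_eq_mul]
    field_simp
    linear_combination h a b c d

lemma inv_dec {k V : Type*} [Field k] [AddCommGroup V] [Module k V]
    [FiniteDimensional k V] (A : (⋀[k]^2 V) ≃ₗ[k] (⋀[k]^2 V))
    (hA : ∀ ω : ⋀[k]^2 V, (∃ v w : V, ω = exteriorPower.ιMulti k 2 ![v, w]) →
      ∃ v w : V, A ω = exteriorPower.ιMulti k 2 ![v, w]) (ω : ⋀[k]^2 V)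
    (h : ∃ v w : V, A ω = exteriorPower.ιMulti k 2 ![v, w]) :
    ∃ v w : V, ω = exteriorPower.ιMulti k 2 ![v, w] := by
  refine quad_inv A {ω | ∃ v w : V, ω = exteriorPower.ιMulti k 2 ![v, w]} hA ?_ ω h
  intro x hx
  apply dec_of_quad
  intro a b c d
  refine hx ((bpair a b : _ → k) * (bpair c d : _ → k) - (bpair a c : _ → k) * (bpair b d : _ → k)
    + (bpair a d : _ → k) * (bpair b c : _ → k)) ?_ ?_
  · exact add_mem (sub_mem (Submodule.mul_mem_mul (mem_linFun _) (mem_linFun _))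
      (Submodule.mul_mem_mul (mem_linFun _) (mem_linFun _)))
      (Submodule.mul_mem_mul (mem_linFun _) (mem_linFun _))
  · rintro _ ⟨v, w, rfl⟩
    simp only [Pi.add_apply, Pi.sub_apply, Pi.mul_apply, bpair_mul]
    ring

theorem stmt_4 {k V : Type*} [Field k] [AddCommGroup V] [Module k V]
    [FiniteDimensional k V] (hdim : 2 ≤ Module.finrank k V)
    (A : (⋀[k]^2 V) ≃ₗ[k] (⋀[k]^2 V))
    (hdec : ∀ ω : ⋀[k]^2 V,
      (∃ v w : V, (ω : ExteriorAlgebra k V) = ExteriorAlgebra.ι k v * ExteriorAlgebra.ι k w) →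
      ∃ v w : V, ((A ω : ⋀[k]^2 V) : ExteriorAlgebra k V)
        = ExteriorAlgebra.ι k v * ExteriorAlgebra.ι k w)
    (Gset : Set (Projectivization k (⋀[k]^2 V)))
    (hGset : Gset = {x | ∃ v w : V,
      ((x.rep : ⋀[k]^2 V) : ExteriorAlgebra k V)
        = ExteriorAlgebra.ι k v * ExteriorAlgebra.ι k w})
    (hmaps : Set.MapsTo (Projectivization.map A.toLinearMap A.injective) Gset Gset) :
    Set.BijOn (Projectivization.map A.toLinearMap A.injective) Gset Gset := by
  refine ⟨hmaps, (Projectivization.map_injective _ _).injOn, ?_⟩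
  subst hGset
  rintro y ⟨v, w, hy⟩
  have hne : A.symm y.rep ≠ 0 := by simpa using y.rep_nonzero
  refine ⟨Projectivization.mk k (A.symm y.rep) hne, ?_, ?_⟩
  · obtain ⟨v', w', h'⟩ := inv_dec A (by simpa only [dec_iff] using hdec) (A.symm y.rep)
      ⟨v, w, by rw [A.apply_symm_apply]; exact (dec_iff _ _ _).1 hy⟩
    obtain ⟨a, ha⟩ := Projectivization.exists_smul_eq_mk_rep k (A.symm y.rep) hne
    refine ⟨(a : k) • v', w', ?_⟩
    rw [← ha, Units.smul_def, Submodule.coe_smul, (dec_iff _ _ _).2 h', map_smul, smul_mul_assoc]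
  · rw [Projectivization.map_mk]
    conv_rhs => rw [← y.mk_rep]
    congr 1
    simp
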